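/- Let A, B : ℝ → ℝ be C¹ functions, let g, V, β : ℝ² → ℝ be C² functions and let Q : ℝ² → ℝ be a C² function. Suppose that for all (x,y) ∈ ℝ²: ∂β/∂y = A(x)·∂g/∂x + (g/2)·A'(x), ∂β/∂x = B(y)·∂g/∂y + (g/2)·B'(y), ∂Q/∂y = 2 g A(x)·∂V/∂x − 2β·∂V/∂y, and ∂Q/∂x = 2 g B(y)·∂V/∂y − 2β·∂V/∂x. Then V satisfies g·(3B'(y)·∂V/∂y + 2B(y)·∂²V/∂y² − 3A'(x)·∂V/∂x − 2A(x)·∂²V/∂x²) + 4B(y)·(∂g/∂y)·(∂V/∂y) − 4A(x)·(∂g/∂x)·(∂V/∂x) = 0 everywhere. -/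

import Mathlib

theorem hasDerivAt_slice_fst {f : ℝ × ℝ → ℝ} (hf : Differentiable ℝ f) (x y : ℝ) :
    HasDerivAt (fun t : ℝ => f (t, y)) (fderiv ℝ f (x, y) (1, 0)) x :=
  (hf (x, y)).hasFDerivAt.comp_hasDerivAt x ((hasDerivAt_id x).prodMk (hasDerivAt_const x y))

theorem hasDerivAt_slice_snd {f : ℝ × ℝ → ℝ} (hf : Differentiable ℝ f) (x y : ℝ) :
    HasDerivAt (fun t : ℝ => f (x, t)) (fderiv ℝ f (x, y) (0, 1)) y :=
  (hf (x, y)).hasFDerivAt.comp_hasDerivAt y ((hasDerivAt_const y x).prodMk (hasDerivAt_id y))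

theorem differentiable_deriv_slice_fst {f : ℝ × ℝ → ℝ} (hf : ContDiff ℝ 2 f) :
    Differentiable ℝ (fun p : ℝ × ℝ => deriv (fun t : ℝ => f (t, p.2)) p.1) := by
  have h : (fun p : ℝ × ℝ => deriv (fun t : ℝ => f (t, p.2)) p.1) =
      fun p => fderiv ℝ f p (1, 0) :=
    funext fun p => (hasDerivAt_slice_fst (hf.differentiable (by norm_num)) p.1 p.2).deriv
  rw [h]
  exact ((hf.fderiv_right (m := 1) (by norm_num)).differentiable (by norm_num)).clm_apply
    (differentiable_const _)

theorem differentiable_deriv_slice_snd {f : ℝ × ℝ → ℝ} (hf : ContDiff ℝ 2 f) :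
    Differentiable ℝ (fun p : ℝ × ℝ => deriv (fun t : ℝ => f (p.1, t)) p.2) := by
  have h : (fun p : ℝ × ℝ => deriv (fun t : ℝ => f (p.1, t)) p.2) =
      fun p => fderiv ℝ f p (0, 1) :=
    funext fun p => (hasDerivAt_slice_snd (hf.differentiable (by norm_num)) p.1 p.2).deriv
  rw [h]
  exact ((hf.fderiv_right (m := 1) (by norm_num)).differentiable (by norm_num)).clm_apply
    (differentiable_const _)

/-- Equality of the mixed second partial derivatives of a `C²` function on the plane. -/
theorem deriv_deriv_slice_comm {f : ℝ × ℝ → ℝ} (hf : ContDiff ℝ 2 f) (x y : ℝ) :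
    deriv (fun s : ℝ => deriv (fun t : ℝ => f (s, t)) y) x =
      deriv (fun t : ℝ => deriv (fun s : ℝ => f (s, t)) x) y := by
  have hd : Differentiable ℝ f := hf.differentiable (by norm_num)
  have hd' : Differentiable ℝ (fderiv ℝ f) :=
    (hf.fderiv_right (m := 1) (by norm_num)).differentiable (by norm_num)
  have e1 : (fun s : ℝ => deriv (fun t : ℝ => f (s, t)) y) =
      fun s => fderiv ℝ f (s, y) (0, 1) :=
    funext fun s => (hasDerivAt_slice_snd hd s y).deriv
  have e2 : (fun t : ℝ => deriv (fun s : ℝ => f (s, t)) x) =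
      fun t => fderiv ℝ f (x, t) (1, 0) :=
    funext fun t => (hasDerivAt_slice_fst hd x t).deriv
  have k1 : HasDerivAt (fun s : ℝ => fderiv ℝ f (s, y)) (fderiv ℝ (fderiv ℝ f) (x, y) (1, 0)) x :=
    (hd' (x, y)).hasFDerivAt.comp_hasDerivAt x ((hasDerivAt_id x).prodMk (hasDerivAt_const x y))
  have k2 : HasDerivAt (fun t : ℝ => fderiv ℝ f (x, t)) (fderiv ℝ (fderiv ℝ f) (x, y) (0, 1)) y :=
    (hd' (x, y)).hasFDerivAt.comp_hasDerivAt y ((hasDerivAt_const y x).prodMk (hasDerivAt_id y))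
  have l1 := (k1.clm_apply (hasDerivAt_const x ((0, 1) : ℝ × ℝ))).deriv
  have l2 := (k2.clm_apply (hasDerivAt_const y ((1, 0) : ℝ × ℝ))).deriv
  rw [e1, e2, l1, l2]
  simpa using second_derivative_symmetric (fun p => (hd p).hasFDerivAt) (hd' (x, y)).hasFDerivAt
    (1, 0) (0, 1)

/-- Bertrand–Darboux type compatibility equation for the potential `V`,
obtained by equating the mixed second partial derivatives of `Q`. -/
theorem stmt_7 (A B : ℝ → ℝ) (hA : ContDiff ℝ 1 A) (hB : ContDiff ℝ 1 B)
    (g V β : ℝ × ℝ → ℝ) (hg : ContDiff ℝ 2 g) (hV : ContDiff ℝ 2 V)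
    (hβ : ContDiff ℝ 2 β)
    (Q : ℝ × ℝ → ℝ) (hQ : ContDiff ℝ 2 Q)
    (h1 : ∀ x y : ℝ,
      deriv (fun y' : ℝ => β (x, y')) y =
        A x * deriv (fun x' : ℝ => g (x', y)) x + g (x, y) / 2 * deriv A x)
    (h2 : ∀ x y : ℝ,
      deriv (fun x' : ℝ => β (x', y)) x =
        B y * deriv (fun y' : ℝ => g (x, y')) y + g (x, y) / 2 * deriv B y)
    (h3 : ∀ x y : ℝ,
      deriv (fun y' : ℝ => Q (x, y')) y =
        2 * g (x, y) * A x * deriv (fun x' : ℝ => V (x', y)) x -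
          2 * β (x, y) * deriv (fun y' : ℝ => V (x, y')) y)
    (h4 : ∀ x y : ℝ,
      deriv (fun x' : ℝ => Q (x', y)) x =
        2 * g (x, y) * B y * deriv (fun y' : ℝ => V (x, y')) y -
          2 * β (x, y) * deriv (fun x' : ℝ => V (x', y)) x) :
    ∀ x y : ℝ,
      g (x, y) *
          (3 * deriv B y * deriv (fun y' : ℝ => V (x, y')) y +
            2 * B y * deriv (deriv (fun y' : ℝ => V (x, y'))) y -
            3 * deriv A x * deriv (fun x' : ℝ => V (x', y)) x -
            2 * A x * deriv (deriv (fun x' : ℝ => V (x', y))) x) +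
        4 * B y * deriv (fun y' : ℝ => g (x, y')) y *
          deriv (fun y' : ℝ => V (x, y')) y -
        4 * A x * deriv (fun x' : ℝ => g (x', y)) x *
          deriv (fun x' : ℝ => V (x', y)) x = 0 := by
  intro x y
  have hgd : Differentiable ℝ g := hg.differentiable (by norm_num)
  have hβd : Differentiable ℝ β := hβ.differentiable (by norm_num)
  have hAx := (hA.differentiable (by norm_num) x).hasDerivAt
  have hBy := (hB.differentiable (by norm_num) y).hasDerivAt
  have gx := (hasDerivAt_slice_fst hgd x y).differentiableAt.hasDerivAt
  have gy := (hasDerivAt_slice_snd hgd x y).differentiableAt.hasDerivAt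
  have βx := (hasDerivAt_slice_fst hβd x y).differentiableAt.hasDerivAt
  have βy := (hasDerivAt_slice_snd hβd x y).differentiableAt.hasDerivAt
  have Vxx := (hasDerivAt_slice_fst
    (differentiable_deriv_slice_fst hV) x y).differentiableAt.hasDerivAt
  have Vxy := (hasDerivAt_slice_snd
    (differentiable_deriv_slice_fst hV) x y).differentiableAt.hasDerivAt
  have Vyx := (hasDerivAt_slice_fst
    (differentiable_deriv_slice_snd hV) x y).differentiableAt.hasDerivAt
  have Vyy := (hasDerivAt_slice_snd
    (differentiable_deriv_slice_snd hV) x y).differentiableAt.hasDerivAt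
  have hQxy := deriv_deriv_slice_comm hQ x y
  simp only [h3, h4] at hQxy
  have d1 := ((((gx.const_mul 2).mul hAx).mul Vxx).sub ((βx.const_mul 2).mul Vyx)).deriv
  have d2 := ((((gy.const_mul 2).mul hBy).mul Vyy).sub ((βy.const_mul 2).mul Vxy)).deriv
  have hE := d1.symm.trans (hQxy.trans d2)
  have hVxy := deriv_deriv_slice_comm hV x y
  dsimp only at hE
  simp only [Pi.mul_apply] at hE
  rw [hVxy, h1, h2] at hE
  linear_combination -hE
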